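/- (Modular law) Let ρ : A → P be a basic scaling and let x, y, z ∈ A satisfy x ∧ y = 0 and y ∨ z = 1. If u, w ∈ A satisfy u ∨ w = 1, ρ(u) = ρ(x ∨ y), and ρ(w) = ρ(z), and if p, q ∈ A satisfy p ∧ q = 0, ρ(p) = ρ(x), and ρ(q) = ρ(y ∧ z), then ρ(u ∧ w) = ρ(p ∨ q). (In sum-notation: {ρ(x) + ρ(y)} ⊕ ρ(z) = ρ(x) + {ρ(y) ⊕ ρ(z)}, all sums and dual-sums existing.) -/

import Mathlib

/-- A *basic scaling* is a strictly increasing map from a Boolean algebra to a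
partially ordered set that preserves relative complementation. -/
structure IsBasicScaling {A P : Type*} [BooleanAlgebra A] [PartialOrder P]
    (ρ : A → P) : Prop where
  mono : ∀ x y : A, x < y → ρ x < ρ y
  relcomp_lt : ∀ a b x y : A, a ≤ x → x ≤ b → a ≤ y → y ≤ b →
      ρ x < ρ y → ρ (a ⊔ (b ⊓ yᶜ)) < ρ (a ⊔ (b ⊓ xᶜ))
  relcomp_eq : ∀ a b x y : A, a ≤ x → x ≤ b → a ≤ y → y ≤ b →
      ρ x = ρ y → ρ (a ⊔ (b ⊓ xᶜ)) = ρ (a ⊔ (b ⊓ yᶜ))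

/-- A basic scaling is *divided* if whenever `ρ x < ρ y` there is `y₁ < y`
with `ρ y₁ = ρ x`. -/
def Divided {A P : Type*} [BooleanAlgebra A] [PartialOrder P] (ρ : A → P) : Prop :=
  ∀ x y : A, ρ x < ρ y → ∃ y₁, y₁ < y ∧ ρ y₁ = ρ x

namespace IsBasicScaling

variable {A P : Type*} [BooleanAlgebra A] [PartialOrder P] {ρ : A → P}

theorem compl_congr (h : IsBasicScaling ρ) {x y : A} (hxy : ρ x = ρ y) : ρ xᶜ = ρ yᶜ := by
  simpa using h.relcomp_eq ⊥ ⊤ x y bot_le le_top bot_le le_top hxy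

theorem sup_congr_left (h : IsBasicScaling ρ) {x y c : A} (hx : Disjoint x c)
    (hy : Disjoint y c) (hxy : ρ x = ρ y) : ρ (x ⊔ c) = ρ (y ⊔ c) := by
  have hdiff : ρ (y \ x ⊔ c) = ρ (x \ y ⊔ c) := by
    have key := h.relcomp_eq ⊥ (x ⊔ y ⊔ c) x y bot_le (le_sup_left.trans le_sup_left) bot_le
      (le_sup_right.trans le_sup_left) hxy
    simpa [← sdiff_eq, sup_sdiff, hx.symm.sdiff_eq_left, hy.symm.sdiff_eq_left] using key
  have key := h.relcomp_eq c (x ⊔ y ⊔ c) (y \ x ⊔ c) (x \ y ⊔ c) le_sup_right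
    (sup_le_sup_right (sdiff_le.trans le_sup_right) c) le_sup_right
    (sup_le_sup_right (sdiff_le.trans le_sup_left) c) hdiff
  have relcomp : ∀ s t : A, c ⊔ ((s ⊔ t ⊔ c) ⊓ (t \ s ⊔ c)ᶜ) = s ⊔ c := by
    intro s t
    rw [← sdiff_eq, ← sup_sdiff_self_right s t, sup_assoc, sup_sdiff, sdiff_self, sup_bot_eq,
      ← sdiff_sdiff_left, disjoint_sdiff_self_right.sdiff_eq_left, sup_sdiff_self_right,
      sup_comm]
  rw [relcomp x y, sup_comm x y, relcomp y x] at key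
  exact key

/-- The sum of a basic scaling does not depend on the choice of disjoint representatives. -/
theorem sup_congr (h : IsBasicScaling ρ) {x y x' y' : A} (hd : Disjoint x y)
    (hd' : Disjoint x' y') (hx : ρ x = ρ x') (hy : ρ y = ρ y') :
    ρ (x ⊔ y) = ρ (x' ⊔ y') := by
  have hleft : ρ (x ⊔ y \ x') = ρ (x' ⊔ y) := by
    simpa using h.sup_congr_left (hd.mono_right sdiff_le) disjoint_sdiff_self_right hx
  have hright : ρ (x' ⊔ y) = ρ (y' ⊔ x' \ y) := by
    simpa [sup_comm] using
      h.sup_congr_left disjoint_sdiff_self_right (hd'.symm.mono_right sdiff_le) hy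
  have key := h.sup_congr_left (c := x' ⊓ y)
    (disjoint_sup_left.2 ⟨hd.mono_right inf_le_right,
      disjoint_sdiff_self_left.mono_right inf_le_left⟩)
    (disjoint_sup_left.2 ⟨hd'.symm.mono_right inf_le_left,
      disjoint_sdiff_self_left.mono_right inf_le_right⟩) (hleft.trans hright)
  rwa [sup_assoc, sup_assoc, inf_comm, sup_comm (y \ x'), sup_inf_sdiff, inf_comm,
    sup_comm (x' \ y), sup_inf_sdiff, sup_comm y'] at key

/-- The dual sum of a basic scaling does not depend on the choice of codisjoint
representatives. -/
theorem inf_congr (h : IsBasicScaling ρ) {x y x' y' : A} (hc : Codisjoint x y)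
    (hc' : Codisjoint x' y') (hx : ρ x = ρ x') (hy : ρ y = ρ y') :
    ρ (x ⊓ y) = ρ (x' ⊓ y') := by
  have key := h.compl_congr (h.sup_congr
    (disjoint_compl_right_iff.2 (codisjoint_iff_compl_le_right.1 hc))
    (disjoint_compl_right_iff.2 (codisjoint_iff_compl_le_right.1 hc'))
    (h.compl_congr hx) (h.compl_congr hy))
  simpa using key

end IsBasicScaling

theorem stmt_5 {A P : Type*} [BooleanAlgebra A] [PartialOrder P] (ρ : A → P)
    (h : IsBasicScaling ρ) (x y z : A)
    (hxy : x ⊓ y = ⊥) (hyz : y ⊔ z = ⊤)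
    (u w : A) (huw : u ⊔ w = ⊤) (hu : ρ u = ρ (x ⊔ y)) (hw : ρ w = ρ z)
    (p q : A) (hpq : p ⊓ q = ⊥) (hp : ρ p = ρ x) (hq : ρ q = ρ (y ⊓ z)) :
    ρ (u ⊓ w) = ρ (p ⊔ q) := by
  have hxz : x ≤ z :=
    (le_compl_iff_disjoint_right.2 (disjoint_iff.2 hxy)).trans
      (codisjoint_iff_compl_le_right.1 (codisjoint_iff.2 hyz))
  have hinf : ρ (u ⊓ w) = ρ ((x ⊔ y) ⊓ z) :=
    h.inf_congr (codisjoint_iff.2 huw)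
      (codisjoint_iff.2 (by rw [sup_assoc, hyz, sup_top_eq])) hu hw
  have hsup : ρ (p ⊔ q) = ρ (x ⊔ y ⊓ z) :=
    h.sup_congr (disjoint_iff.2 hpq) ((disjoint_iff.2 hxy).mono_right inf_le_left) hp hq
  rw [hinf, hsup, sup_inf_assoc_of_le y hxz]
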